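/- arXiv:1508.05034 — 3 statements merged into one kernel-verified Lean document; each statement's English description precedes it below -/
import Mathlib

section
/- Let A and 𝔄 be two time-varying signed adjacency matrices that are essentially equivalent, meaning ∫_0^∞ |𝔄_{ij}(t) − a_{ij}(t)| dt < ∞ for all i,j. Then for every ε > 0 there exists T₀ = T₀(ε) ≥ 0 such that: if x is a solution of ẋ = −L[A(t)]x, ξ is a solution of ξ̇ = −L[𝔄(t)]ξ, and ξ(T₀) = x(T₀) lies in the unit ball {y : |y|_∞ ≤ 1}, then |x(t) − ξ(t)|_∞ ≤ ε for all t ≥ T₀. -/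
open MeasureTheory Filter Matrix Finset Topology

/-- The signed Laplacian `L[A]` of a signed adjacency matrix:
off-diagonal entries `L j k = -A j k`, diagonal entries `L j j = ∑ m, |A j m|`. -/
noncomputable def sLap {N : ℕ} (A : Matrix (Fin N) (Fin N) ℝ) : Matrix (Fin N) (Fin N) ℝ :=
  fun j k => if j = k then ∑ m, |A j m| else -A j k

/-- A time-varying signed adjacency matrix: entrywise measurable, locally bounded,
with zero diagonal. -/
def IsAdjacency {N : ℕ} (A : ℝ → Matrix (Fin N) (Fin N) ℝ) : Prop :=
  (∀ j k, Measurable fun t => A t j k) ∧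
  (∀ T : ℝ, ∃ C : ℝ, ∀ t ∈ Set.Icc (0:ℝ) T, ∀ j k, |A t j k| ≤ C) ∧
  (∀ t j, A t j j = 0)

/-- A solution of `ẋ = −L[A(t)]x` on `[0,∞)`: continuous and satisfying the integral
equation (equivalently, locally absolutely continuous and satisfying the ODE a.e.). -/
def IsSolution {N : ℕ} (A : ℝ → Matrix (Fin N) (Fin N) ℝ) (x : ℝ → Fin N → ℝ) : Prop :=
  ContinuousOn x (Set.Ici 0) ∧
  ∀ t ∈ Set.Ici (0:ℝ), ∀ j,
    x t j = x 0 j + ∫ s in (0:ℝ)..t, -((sLap (A s)).mulVec (x s) j)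

/-- Quasi-strong connectivity of the static signed graph `G[A]`: some root reaches
every node along arcs `k → j` present whenever `A j k ≠ 0`. -/
def QSC {N : ℕ} (A : Matrix (Fin N) (Fin N) ℝ) : Prop :=
  ∃ r : Fin N, ∀ j : Fin N, Relation.ReflTransGen (fun k j => A j k ≠ 0) r j

/-- Structural balance of the static signed graph `G[A]`: the nodes split into the camp `S`
and its complement (one possibly empty), with nonnegative weights inside a camp and
nonpositive weights between camps. -/
def StructBal {N : ℕ} (A : Matrix (Fin N) (Fin N) ℝ) : Prop :=
  ∃ S : Set (Fin N), ∀ j k : Fin N,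
    ((j ∈ S ↔ k ∈ S) → 0 ≤ A j k) ∧ (¬(j ∈ S ↔ k ∈ S) → A j k ≤ 0)

/-- `∫_0^∞ |a_{jk}(t)| dt = ∞`: arc `k → j` of the graph of essential interactions. -/
def EssArc {N : ℕ} (A : ℝ → Matrix (Fin N) (Fin N) ℝ) (j k : Fin N) : Prop :=
  ∫⁻ t in Set.Ici (0:ℝ), ENNReal.ofReal |A t j k| = ⊤

/-- `∫_0^∞ a_{jk}⁺(t) dt = ∞`: agents `j` and `k` essentially cooperate. -/
def EssPlus {N : ℕ} (A : ℝ → Matrix (Fin N) (Fin N) ℝ) (j k : Fin N) : Prop :=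
  ∫⁻ t in Set.Ici (0:ℝ), ENNReal.ofReal (max (A t j k) 0) = ⊤

/-- `∫_0^∞ a_{jk}⁻(t) dt = ∞`: agents `j` and `k` essentially compete. -/
def EssMinus {N : ℕ} (A : ℝ → Matrix (Fin N) (Fin N) ℝ) (j k : Fin N) : Prop :=
  ∫⁻ t in Set.Ici (0:ℝ), ENNReal.ofReal (max (-(A t j k)) 0) = ⊤

/-- Reachability from `u` to `v` in the graph of essential interactions. -/
def EssReach {N : ℕ} (A : ℝ → Matrix (Fin N) (Fin N) ℝ) (u v : Fin N) : Prop :=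
  Relation.ReflTransGen (fun k j => EssArc A j k) u v

/-- Uniform strong connectivity of the time-varying graph `G[A(·)]`. -/
def USC {N : ℕ} (A : ℝ → Matrix (Fin N) (Fin N) ℝ) : Prop :=
  ∃ T > (0:ℝ), ∃ ε > (0:ℝ), ∀ t ≥ (0:ℝ), ∀ u v : Fin N,
    Relation.ReflTransGen (fun k j => ε ≤ ∫ s in t..(t + T), |A s j k|) u v

/-- Uniform quasi-strong connectivity of the time-varying graph `G[A(·)]`. -/
def UQSC {N : ℕ} (A : ℝ → Matrix (Fin N) (Fin N) ℝ) : Prop :=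
  ∃ T > (0:ℝ), ∃ ε > (0:ℝ), ∀ t ≥ (0:ℝ), ∃ r : Fin N, ∀ j : Fin N,
    Relation.ReflTransGen (fun k j => ε ≤ ∫ s in t..(t + T), |A s j k|) r j

/-- Cut-balance of the time-varying graph `G[A(·)]` with some constant `K ≥ 1`. -/
def CutBalanced {N : ℕ} (A : ℝ → Matrix (Fin N) (Fin N) ℝ) : Prop :=
  ∃ K : ℝ, 1 ≤ K ∧ ∀ᵐ t ∂(volume.restrict (Set.Ici (0:ℝ))),
    ∀ V : Finset (Fin N), V.Nonempty → V ≠ Finset.univ →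
      K⁻¹ * (∑ j ∈ V, ∑ k ∈ Vᶜ, |A t k j|) ≤ (∑ j ∈ V, ∑ k ∈ Vᶜ, |A t j k|) ∧
      (∑ j ∈ V, ∑ k ∈ Vᶜ, |A t j k|) ≤ K * (∑ j ∈ V, ∑ k ∈ Vᶜ, |A t k j|)

/-- The protocol establishes modulus consensus: the moduli of all opinions converge
to a common limit for every solution. -/
def ModulusConsensus {N : ℕ} (A : ℝ → Matrix (Fin N) (Fin N) ℝ) : Prop :=
  ∀ x : ℝ → Fin N → ℝ, IsSolution A x →
    ∃ c : ℝ, 0 ≤ c ∧ ∀ i, Tendsto (fun t => |x t i|) atTop (𝓝 c)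

/-- The protocol establishes bipartite consensus: there are `v ≠ 0` and `ρ ∈ {±1}^N` such that
every solution converges to `ρ (vᵀ x(0))`. -/
def BipartiteConsensus {N : ℕ} (A : ℝ → Matrix (Fin N) (Fin N) ℝ) : Prop :=
  ∃ v ρ : Fin N → ℝ, v ≠ 0 ∧ (∀ i, ρ i = 1 ∨ ρ i = -1) ∧
    ∀ x : ℝ → Fin N → ℝ, IsSolution A x →
      ∀ i, Tendsto (fun t => x t i) atTop (𝓝 (ρ i * ∑ j, v j * x 0 j))

/-- The essential-interaction signed graph `𝒢^±` is structurally balanced: the camp `S` and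
its complement contain all essentially-cooperating pairs inside a camp and all
essentially-competing pairs between the camps. -/
def EssStructBal {N : ℕ} (A : ℝ → Matrix (Fin N) (Fin N) ℝ) : Prop :=
  ∃ S : Set (Fin N),
    (∀ j k, EssPlus A j k → (j ∈ S ↔ k ∈ S)) ∧
    (∀ j k, EssMinus A j k → ¬(j ∈ S ↔ k ∈ S))

theorem sLap_mulVec_apply {N : ℕ} (A : Matrix (Fin N) (Fin N) ℝ) (z : Fin N → ℝ) (j : Fin N) :
    (sLap A).mulVec z j =
      (∑ m, |A j m|) * z j - ∑ k, (if j = k then 0 else A j k) * z k := by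
  have h : ∀ k, sLap A j k * z k =
      (if j = k then (∑ m, |A j m|) * z k else 0) - (if j = k then 0 else A j k) * z k := by
    intro k
    by_cases hk : j = k <;> simp [sLap, hk]
  simp only [mulVec, dotProduct, h, Finset.sum_sub_distrib]
  simp

/-- `D • 1 - L[A]` has `ℓ^∞` operator norm at most `D` as soon as `D` dominates the diagonal. -/
theorem abs_mul_sub_sLap_mulVec_le {N : ℕ} (A : Matrix (Fin N) (Fin N) ℝ) (z : Fin N → ℝ)
    (j : Fin N) {D : ℝ} (hD : ∑ m, |A j m| ≤ D) :
    |D * z j - (sLap A).mulVec z j| ≤ D * ‖z‖ := by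
  have hz : ∀ k, |z k| ≤ ‖z‖ := fun k => norm_le_pi_norm z k
  have hsum : |∑ k, (if j = k then 0 else A j k) * z k| ≤ (∑ m, |A j m|) * ‖z‖ := by
    rw [Finset.sum_mul]
    refine (Finset.abs_sum_le_sum_abs _ _).trans (Finset.sum_le_sum fun k _ => ?_)
    rw [abs_mul]
    refine mul_le_mul ?_ (hz k) (abs_nonneg _) (abs_nonneg _)
    split_ifs <;> simp
  have hdiag : |(D - ∑ m, |A j m|) * z j| ≤ (D - ∑ m, |A j m|) * ‖z‖ := by
    rw [abs_mul, abs_of_nonneg (sub_nonneg.2 hD)]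
    exact mul_le_mul_of_nonneg_left (hz j) (sub_nonneg.2 hD)
  calc |D * z j - (sLap A).mulVec z j|
      = |(D - ∑ m, |A j m|) * z j + ∑ k, (if j = k then 0 else A j k) * z k| := by
        rw [sLap_mulVec_apply]; ring_nf
    _ ≤ _ := abs_add_le _ _
    _ ≤ D * ‖z‖ := by linarith

theorem abs_sLap_mulVec_sub_le {N : ℕ} (A B : Matrix (Fin N) (Fin N) ℝ) (z : Fin N → ℝ)
    (j : Fin N) :
    |(sLap B).mulVec z j - (sLap A).mulVec z j| ≤ 2 * (∑ m, |B j m - A j m|) * ‖z‖ := by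
  have hz : ∀ k, |z k| ≤ ‖z‖ := fun k => norm_le_pi_norm z k
  have hdiag : |((∑ m, |B j m|) - ∑ m, |A j m|) * z j| ≤ (∑ m, |B j m - A j m|) * ‖z‖ := by
    rw [abs_mul, ← Finset.sum_sub_distrib]
    refine mul_le_mul ?_ (hz j) (abs_nonneg _) (Finset.sum_nonneg fun _ _ => abs_nonneg _)
    exact (Finset.abs_sum_le_sum_abs _ _).trans
      (Finset.sum_le_sum fun m _ => abs_abs_sub_abs_le_abs_sub _ _)
  have hsum : |∑ k, (if j = k then 0 else B j k - A j k) * z k| ≤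
      (∑ m, |B j m - A j m|) * ‖z‖ := by
    rw [Finset.sum_mul]
    refine (Finset.abs_sum_le_sum_abs _ _).trans (Finset.sum_le_sum fun k _ => ?_)
    rw [abs_mul]
    refine mul_le_mul ?_ (hz k) (abs_nonneg _) (abs_nonneg _)
    split_ifs <;> simp
  have hsplit : ∑ k, (if j = k then 0 else B j k - A j k) * z k =
      ∑ k, (if j = k then 0 else B j k) * z k - ∑ k, (if j = k then 0 else A j k) * z k := by
    rw [← Finset.sum_sub_distrib]
    refine Finset.sum_congr rfl fun k _ => ?_
    split_ifs <;> ring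
  calc |(sLap B).mulVec z j - (sLap A).mulVec z j|
      = |((∑ m, |B j m|) - ∑ m, |A j m|) * z j -
          ∑ k, (if j = k then 0 else B j k - A j k) * z k| := by
        rw [sLap_mulVec_apply, sLap_mulVec_apply, hsplit]; ring_nf
    _ ≤ _ := abs_sub _ _
    _ ≤ _ := by linarith

/-- The sup-norm of a solution of the protocol `ẏ = -L[M(t)] y` perturbed by a forcing term
bounded by `g` grows by at most `∫ g`. -/
theorem norm_le_norm_add_integral_of_perturbed {N : ℕ} [NeZero N] {a b D : ℝ} (hab : a ≤ b)
    {M : ℝ → Matrix (Fin N) (Fin N) ℝ} {y F : ℝ → Fin N → ℝ} {g : ℝ → ℝ}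
    (hy : ContinuousOn y (Set.Icc a b))
    (hF : ∀ j, IntervalIntegrable (fun r => F r j) volume a b)
    (hyF : ∀ s ∈ Set.Icc a b, ∀ t ∈ Set.Icc a b, ∀ j, y t j - y s j = ∫ r in s..t, F r j)
    (hg : IntervalIntegrable g volume a b)
    (hD : ∀ r ∈ Set.Icc a b, ∀ j, ∑ m, |M r j m| ≤ D)
    (hFg : ∀ r ∈ Set.Icc a b, ∀ j, |F r j + (sLap (M r)).mulVec (y r) j| ≤ g r) :
    ‖y b‖ ≤ ‖y a‖ + ∫ r in a..b, g r := by
  wlog hD0 : 0 < D generalizing D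
  · exact this (D := max D 1) (fun r hr j => (hD r hr j).trans (le_max_left _ _)) (by positivity)
  have hsub : ∀ s ∈ Set.Icc a b, ∀ t ∈ Set.Icc a b, Set.uIcc s t ⊆ Set.uIcc a b := by
    intro s hs t ht
    rw [Set.uIcc_of_le hab]
    exact Set.uIcc_subset_Icc hs ht
  have hga : ∀ s ∈ Set.Icc a b, IntervalIntegrable g volume a s := fun s hs =>
    hg.mono_set (hsub a ⟨le_rfl, hab⟩ s hs)
  have hcont : ContinuousOn (fun t => ‖y t‖ - ∫ r in a..t, g r) (Set.Icc a b) := by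
    refine hy.norm.sub ?_
    rw [← Set.uIcc_of_le hab]
    exact intervalIntegral.continuousOn_primitive_interval ((intervalIntegrable_iff').1 hg)
  have key := image_le_of_liminf_slope_right_le_deriv_boundary (a := a) (b := b)
    (B := fun _ => ‖y a‖) (B' := fun _ => 0) hcont (by simp) continuousOn_const
    (fun _ _ => hasDerivWithinAt_const _ _ _) ?_ (Set.right_mem_Icc.2 hab)
  · linarith
  intro s hs η hη
  have hsI : s ∈ Set.Icc a b := Set.Ico_subset_Icc_self hs
  set δ := η / (4 * D) with hδ
  have hδ0 : 0 < δ := by positivity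
  obtain ⟨ρ, hρ, hρy⟩ := Metric.continuousWithinAt_iff.1 (hy s hsI) δ hδ0
  have hstep : 0 < min ρ D⁻¹ := lt_min hρ (inv_pos.2 hD0)
  have hev : ∀ᶠ t in 𝓝[>] s, t ∈ Set.Ioo s (min b (s + min ρ D⁻¹)) :=
    Ioo_mem_nhdsGT (lt_min hs.2 (by linarith))
  refine Eventually.frequently (hev.mono fun t ht => ?_)
  have hst : s < t := ht.1
  have htb : t < b := ht.2.trans_le (min_le_left _ _)
  have hts : t < s + min ρ D⁻¹ := ht.2.trans_le (min_le_right _ _)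
  have htρ : t - s < ρ := by linarith [min_le_left ρ D⁻¹]
  have htD : (t - s) * D ≤ 1 := by
    have : t - s ≤ D⁻¹ := by linarith [min_le_right ρ D⁻¹]
    calc (t - s) * D ≤ D⁻¹ * D := by gcongr
      _ = 1 := inv_mul_cancel₀ hD0.ne'
  have htI : t ∈ Set.Icc a b := ⟨hs.1.trans hst.le, htb.le⟩
  have hgst : IntervalIntegrable g volume s t := hg.mono_set (hsub s hsI t htI)
  have hbound : ∀ j, |y t j| ≤ ‖y s‖ + (t - s) * (2 * D * δ) + ∫ r in s..t, g r := by
    intro j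
    have hFst : IntervalIntegrable (fun r => F r j) volume s t :=
      (hF j).mono_set (hsub s hsI t htI)
    have hsplit : y t j = (1 - (t - s) * D) * y s j + ∫ r in s..t, (D * y s j + F r j) := by
      rw [intervalIntegral.integral_add intervalIntegrable_const hFst, ← hyF s hsI t htI j]
      simp
      ring
    have hpt : ∀ r ∈ Set.Ioc s t, ‖D * y s j + F r j‖ ≤ (D * ‖y s‖ + 2 * D * δ) + g r := by
      intro r hr
      have hrI : r ∈ Set.Icc a b := ⟨hs.1.trans hr.1.le, hr.2.trans htb.le⟩
      have hdist : ‖y r - y s‖ ≤ δ := by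
        rw [← dist_eq_norm]
        refine (hρy hrI ?_).le
        rw [Real.dist_eq, abs_of_pos (sub_pos.2 hr.1)]
        linarith [hr.2]
      have hj : |y s j - y r j| ≤ δ := by
        rw [abs_sub_comm]
        exact (norm_le_pi_norm (y r - y s) j).trans hdist
      have hnorm : ‖y r‖ ≤ ‖y s‖ + δ := by
        linarith [norm_sub_norm_le (y r) (y s)]
      have h1 := abs_mul_sub_sLap_mulVec_le (M r) (y r) j (hD r hrI j)
      have h2 := hFg r hrI j
      have h3 : |D * (y s j - y r j)| ≤ D * δ := by
        rw [abs_mul, abs_of_pos hD0]; gcongr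
      have h4 : D * ‖y r‖ ≤ D * (‖y s‖ + δ) := by gcongr
      rw [Real.norm_eq_abs]
      rw [abs_le] at *
      constructor <;> linarith [h1.1, h1.2, h2.1, h2.2, h3.1, h3.2]
    have hint := intervalIntegral.norm_integral_le_of_norm_le hst.le
      (ae_of_all volume hpt) (intervalIntegrable_const.add hgst)
    rw [intervalIntegral.integral_add intervalIntegrable_const hgst,
      intervalIntegral.integral_const, smul_eq_mul, Real.norm_eq_abs] at hint
    have hfirst : |(1 - (t - s) * D) * y s j| ≤ (1 - (t - s) * D) * ‖y s‖ := by
      rw [abs_mul, abs_of_nonneg (sub_nonneg.2 htD)]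
      exact mul_le_mul_of_nonneg_left (norm_le_pi_norm (y s) j) (sub_nonneg.2 htD)
    rw [hsplit]
    refine (abs_add_le _ _).trans ?_
    linarith
  have hyt : ‖y t‖ ≤ ‖y s‖ + (t - s) * (2 * D * δ) + ∫ r in s..t, g r :=
    (pi_norm_le_iff_of_nonempty _).2 hbound
  have hDδ : 2 * D * δ = η / 2 := by
    rw [hδ]; field_simp; norm_num
  have hadd := intervalIntegral.integral_add_adjacent_intervals (hga s hsI) hgst
  rw [slope_def_field, div_lt_iff₀ (sub_pos.2 hst)]
  rw [hDδ] at hyt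
  nlinarith [mul_pos hη (sub_pos.2 hst)]

theorem IsAdjacency.intervalIntegrable_sLap_mulVec {N : ℕ} {A : ℝ → Matrix (Fin N) (Fin N) ℝ}
    (hA : IsAdjacency A) {x : ℝ → Fin N → ℝ} (hx : ContinuousOn x (Set.Ici 0)) {a b : ℝ}
    (ha : 0 ≤ a) (hb : 0 ≤ b) (j : Fin N) :
    IntervalIntegrable (fun r => (sLap (A r)).mulVec (x r) j) volume a b := by
  obtain ⟨C, hC⟩ := hA.2.1 (max a b)
  have hsub : Set.uIcc a b ⊆ Set.Icc 0 (max a b) :=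
    Set.Icc_subset_Icc_left (le_min ha hb)
  have hentry : ∀ k, IntegrableOn (fun r => A r j k) (Set.uIcc a b) := fun k =>
    Measure.integrableOn_of_bounded (M := C) (by simp)
      (hA.1 j k).aestronglyMeasurable
      ((ae_restrict_iff' measurableSet_uIcc).2 (ae_of_all _ fun r hr => hC r (hsub hr) j k))
  have hx' : ∀ k, ContinuousOn (fun r => x r k) (Set.uIcc a b) := fun k =>
    (continuousOn_pi.1 hx k).mono fun r hr => (hsub hr).1
  rw [intervalIntegrable_iff']
  simp only [mulVec, dotProduct]
  refine integrable_finsetSum _ fun k _ => ?_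
  refine IntegrableOn.mul_continuousOn ?_ (hx' k) isCompact_uIcc
  by_cases hk : j = k
  · simp only [sLap, hk, if_true]
    exact integrable_finsetSum _ fun m _ => hk ▸ (hentry m).abs
  · simp only [sLap, hk, if_false]
    exact (hentry k).neg

theorem IsSolution.sub_eq_integral {N : ℕ} {A : ℝ → Matrix (Fin N) (Fin N) ℝ}
    (hA : IsAdjacency A) {x : ℝ → Fin N → ℝ} (hx : IsSolution A x) {s t : ℝ}
    (hs : 0 ≤ s) (ht : 0 ≤ t) (j : Fin N) :
    x t j - x s j = ∫ r in s..t, -((sLap (A r)).mulVec (x r) j) := by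
  have h : ∀ u, 0 ≤ u →
      IntervalIntegrable (fun r => -((sLap (A r)).mulVec (x r) j)) volume 0 u :=
    fun u hu => (hA.intervalIntegrable_sLap_mulVec hx.1 le_rfl hu j).neg
  rw [hx.2 t ht j, hx.2 s hs j, ← intervalIntegral.integral_interval_sub_left (h t ht) (h s hs)]
  ring

theorem IsAdjacency.exists_rowSum_le {N : ℕ} {A : ℝ → Matrix (Fin N) (Fin N) ℝ}
    (hA : IsAdjacency A) {a b : ℝ} (ha : 0 ≤ a) :
    ∃ D : ℝ, ∀ r ∈ Set.Icc a b, ∀ j, ∑ m, |A r j m| ≤ D := by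
  obtain ⟨C, hC⟩ := hA.2.1 b
  refine ⟨∑ _m : Fin N, C, fun r hr j => Finset.sum_le_sum fun m _ => ?_⟩
  exact hC r ⟨ha.trans hr.1, hr.2⟩ j m

theorem IsSolution.norm_le {N : ℕ} [NeZero N] {A : ℝ → Matrix (Fin N) (Fin N) ℝ}
    (hA : IsAdjacency A) {x : ℝ → Fin N → ℝ} (hx : IsSolution A x) {s t : ℝ}
    (hs : 0 ≤ s) (hst : s ≤ t) : ‖x t‖ ≤ ‖x s‖ := by
  obtain ⟨D, hD⟩ := hA.exists_rowSum_le (b := t) hs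
  have := norm_le_norm_add_integral_of_perturbed (g := fun _ => 0) hst
    (hx.1.mono fun r hr => hs.trans hr.1)
    (fun j => (hA.intervalIntegrable_sLap_mulVec hx.1 hs (hs.trans hst) j).neg)
    (fun u hu v hv j => hx.sub_eq_integral hA (hs.trans hu.1) (hs.trans hv.1) j)
    intervalIntegrable_const hD (fun r _ j => by simp)
  simpa using this

theorem exists_forall_intervalIntegral_le {g : ℝ → ℝ} (hg0 : ∀ r, 0 ≤ g r)
    (hg : IntegrableOn g (Set.Ioi 0)) {ε : ℝ} (hε : 0 < ε) :
    ∃ T : ℝ, 0 ≤ T ∧ ∀ t ≥ T, ∫ r in T..t, g r ≤ ε := by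
  have hlim := intervalIntegral_tendsto_integral_Ioi 0 hg tendsto_id
  obtain ⟨T, hT, hT0⟩ :=
    ((hlim.eventually (lt_mem_nhds (sub_lt_self _ hε))).and (eventually_ge_atTop 0)).exists
  have hint : ∀ t, 0 ≤ t → IntervalIntegrable g volume 0 t := fun t ht =>
    (intervalIntegrable_iff_integrableOn_Ioc_of_le ht).2 (hg.mono_set Set.Ioc_subset_Ioi_self)
  refine ⟨T, hT0, fun t ht => ?_⟩
  have ht0 : 0 ≤ t := hT0.trans ht
  rw [← intervalIntegral.integral_interval_sub_left (hint t ht0) (hint T hT0)]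
  have hle : ∫ r in (0:ℝ)..t, g r ≤ ∫ r in Set.Ioi 0, g r := by
    rw [intervalIntegral.integral_of_le ht0]
    exact setIntegral_mono_set hg (ae_of_all _ hg0) Set.Ioc_subset_Ioi_self.eventuallyLE
  simp only [id] at hT
  linarith

/-- essentially equivalent protocols (`∫_0^∞ |𝔄_{ij} − a_{ij}| dt < ∞`) have
solutions that stay `ε`-close in sup-norm after a sufficiently large matching time `T₀`. -/
theorem stmt7 {N : ℕ} (hN : 2 ≤ N) (A 𝔄 : ℝ → Matrix (Fin N) (Fin N) ℝ)
    (hA : IsAdjacency A) (h𝔄 : IsAdjacency 𝔄)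
    (hee : ∀ i j, ∫⁻ t in Set.Ici (0:ℝ), ENNReal.ofReal |𝔄 t i j - A t i j| ≠ ⊤) :
    ∀ ε > (0:ℝ), ∃ T0 : ℝ, 0 ≤ T0 ∧
      ∀ x ξ : ℝ → Fin N → ℝ, IsSolution A x → IsSolution 𝔄 ξ →
        ξ T0 = x T0 → ‖x T0‖ ≤ 1 →
        ∀ t ≥ T0, ‖x t - ξ t‖ ≤ ε := by
  have : NeZero N := ⟨by omega⟩
  intro ε hε
  set g : ℝ → ℝ := fun r => 2 * ∑ j, ∑ m, |𝔄 r j m - A r j m| with hg_def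
  have hg0 : ∀ r, 0 ≤ g r := fun r => by positivity
  have hg : IntegrableOn g (Set.Ioi 0) := by
    refine Integrable.const_mul ?_ 2
    refine integrable_finsetSum _ fun j _ => integrable_finsetSum _ fun m _ => ?_
    have hmeas : Measurable fun r => |𝔄 r j m - A r j m| := by
      exact ((h𝔄.1 j m).sub (hA.1 j m)).norm
    have hfin : IntegrableOn (fun r => |𝔄 r j m - A r j m|) (Set.Ici 0) :=
      (lintegral_ofReal_ne_top_iff_integrable hmeas.aestronglyMeasurable
        (ae_of_all _ fun _ => abs_nonneg _)).1 (hee j m)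
    exact hfin.mono_set Set.Ioi_subset_Ici_self
  obtain ⟨T, hT0, hT⟩ := exists_forall_intervalIntegral_le hg0 hg hε
  refine ⟨T, hT0, fun x ξ hx hξ hxξ hx1 t ht => ?_⟩
  obtain ⟨D, hD⟩ := hA.exists_rowSum_le (b := t) hT0
  have ht0 : 0 ≤ t := hT0.trans ht
  have hIx := fun {u v : ℝ} (hu : 0 ≤ u) (hv : 0 ≤ v) j =>
    (hA.intervalIntegrable_sLap_mulVec hx.1 hu hv j).neg
  have hIξ := fun {u v : ℝ} (hu : 0 ≤ u) (hv : 0 ≤ v) j =>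
    (h𝔄.intervalIntegrable_sLap_mulVec hξ.1 hu hv j).neg
  have hmain := norm_le_norm_add_integral_of_perturbed (y := fun r => x r - ξ r)
    (F := fun r j => -((sLap (A r)).mulVec (x r) j) - -((sLap (𝔄 r)).mulVec (ξ r) j))
    (g := g) ht ((hx.1.sub hξ.1).mono fun r hr => hT0.trans hr.1)
    (fun j => (hIx hT0 ht0 j).sub (hIξ hT0 ht0 j)) ?_
    ((intervalIntegrable_iff_integrableOn_Ioc_of_le ht).2
      (hg.mono_set fun r hr => hT0.trans_lt hr.1)) hD ?_
  · rw [hxξ, sub_self, norm_zero, zero_add] at hmain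
    exact hmain.trans (hT t ht)
  · intro u hu v hv j
    have hu0 := hT0.trans hu.1
    have hv0 := hT0.trans hv.1
    refine Eq.trans ?_ (intervalIntegral.integral_sub (hIx hu0 hv0 j) (hIξ hu0 hv0 j)).symm
    simp only [Pi.sub_apply, Pi.neg_apply]
    rw [← hx.sub_eq_integral hA hu0 hv0 j, ← hξ.sub_eq_integral h𝔄 hu0 hv0 j]
    ring
  · intro r hr j
    have hξ1 : ‖ξ r‖ ≤ 1 := (hξ.norm_le h𝔄 hT0 hr.1).trans (hxξ ▸ hx1)
    have hrow : ∑ m, |𝔄 r j m - A r j m| ≤ ∑ i, ∑ m, |𝔄 r i m - A r i m| :=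
      Finset.single_le_sum (f := fun i => ∑ m, |𝔄 r i m - A r i m|)
        (fun i _ => by positivity) (Finset.mem_univ j)
    calc |-((sLap (A r)).mulVec (x r) j) - -((sLap (𝔄 r)).mulVec (ξ r) j) +
          (sLap (A r)).mulVec (x r - ξ r) j|
        = |(sLap (𝔄 r)).mulVec (ξ r) j - (sLap (A r)).mulVec (ξ r) j| := by
          rw [Matrix.mulVec_sub, Pi.sub_apply]; ring_nf
      _ ≤ 2 * (∑ m, |𝔄 r j m - A r j m|) * ‖ξ r‖ := abs_sLap_mulVec_sub_le _ _ _ _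
      _ ≤ 2 * (∑ m, |𝔄 r j m - A r j m|) * 1 := by gcongr
      _ ≤ g r := by simp only [hg_def]; linarith
end

section
/- Suppose |A(t)|_∞ ≤ R for almost all t ∈ [t₀,t₁], set θ₀ = e^{−R(t₁−t₀)}, assume the graph of the matrix ∫_{t₀}^{t₁}|a_{jk}(t)|dt is strongly ε-connected, and assume θ := εθ₀² < 1. Let V ⊊ {1,…,N} be nonempty, and let x be a solution of ẋ(t) = −L[A(t)]x(t) with M = |x(t₀)|_∞ and M′ = max_{j∉V}|x_j(t₀)|. Then there exists k ∈ V such that |x_k(t₁)| ≤ θM′ + (1 − θ)M. -/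
open MeasureTheory Filter Matrix Finset Topology

theorem exists_abs_eq_one_mul_eq_abs (u : ℝ) : ∃ σ : ℝ, |σ| = 1 ∧ σ * u = |u| := by
  rcases abs_cases u with h | h
  · exact ⟨1, by simp, by linarith⟩
  · exact ⟨-1, by simp, by linarith⟩

/-- Multiplying an absolutely continuous function by an exponential weight turns a linear differential
inequality into an integral bound. -/
theorem integral_le_exp_mul_sub {a b R : ℝ} (hab : a ≤ b) {z w g : ℝ → ℝ}
    (hw : IntervalIntegrable w volume a b)
    (hz : ∀ t ∈ Set.Icc a b, z t = z a + ∫ s in a..t, w s)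
    (hg : IntervalIntegrable g volume a b)
    (hgw : ∀ᵐ t ∂(volume.restrict (Set.Icc a b)),
      g t ≤ Real.exp (R * (t - a)) * (R * z t + w t)) :
    ∫ t in a..b, g t ≤ Real.exp (R * (b - a)) * z b - z a := by
  have hE : AbsolutelyContinuousOnInterval (fun t => Real.exp (R * (t - a))) a b := by
    have hcd : ContDiff ℝ 1 (fun t : ℝ => Real.exp (R * (t - a))) := by fun_prop
    exact hcd.contDiffOn.absolutelyContinuousOnInterval
  have hZ : AbsolutelyContinuousOnInterval (fun t => z a + ∫ s in a..t, w s) a b :=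
    (contDiffOn_const (c := z a)).absolutelyContinuousOnInterval.add (hw.absolutelyContinuousOnInterval_intervalIntegral (by simp))
  have hF := hE.mul hZ
  have key : ∫ t in a..b, g t ≤
      ∫ t in a..b, deriv ((fun t => Real.exp (R * (t - a))) *
        (fun t => z a + ∫ s in a..t, w s)) t := by
    refine intervalIntegral.integral_mono_ae_restrict hab hg hF.intervalIntegrable_deriv ?_
    have h1 := (ae_restrict_iff' (μ := volume) (s := Set.Icc a b) measurableSet_Icc).2
      (by simpa only [Set.uIcc_of_le hab] using hw.ae_hasDerivAt_integral)
    filter_upwards [hgw, h1, ae_restrict_mem measurableSet_Icc] with t ht h1 hmem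
    have hd := h1 a (Set.left_mem_Icc.2 hab)
    have he : HasDerivAt (fun t : ℝ => Real.exp (R * (t - a)))
        (Real.exp (R * (t - a)) * (R * 1)) t :=
      (((hasDerivAt_id t).sub_const a).const_mul R).exp
    rw [(he.mul (hd.const_add (z a))).deriv]
    refine ht.trans (le_of_eq ?_)
    rw [hz t hmem]
    ring
  refine key.trans (le_of_eq ?_)
  rw [hF.integral_deriv_eq_sub, hz b (Set.right_mem_Icc.2 hab)]
  simp

theorem sLap_mulVec {N : ℕ} {B : Matrix (Fin N) (Fin N) ℝ} (hB : ∀ j, B j j = 0)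
    (y : Fin N → ℝ) (i : Fin N) :
    (sLap B).mulVec y i = (∑ m, |B i m|) * y i - ∑ m, B i m * y m := by
  have h : ∀ m, sLap B i m * y m =
      (if i = m then (∑ l, |B i l|) * y m else 0) - B i m * y m := by
    intro m
    by_cases him : i = m
    · subst him
      simp [sLap, hB]
    · simp [sLap, him]
  simp only [Matrix.mulVec, dotProduct, h, Finset.sum_sub_distrib]
  simp

theorem abs_mul_gap_le_sLap {N : ℕ} {B : Matrix (Fin N) (Fin N) ℝ} (hB : ∀ j, B j j = 0)
    {y : Fin N → ℝ} {K R σ : ℝ} (hσ : |σ| = 1) (hK : ∀ m, |y m| ≤ K)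
    (i k : Fin N) (hR : ∑ m, |B i m| ≤ R) :
    |B i k| * (K - |y k|) ≤ R * (K - σ * y i) + σ * (sLap B).mulVec y i := by
  have hterm : ∀ c u : ℝ, σ * (c * u) ≤ |c| * |u| := fun c u =>
    (le_abs_self _).trans (by simp [abs_mul, hσ])
  have hz : 0 ≤ K - σ * y i := by
    have := hterm 1 (y i)
    have := hK i
    simp at *
    linarith
  have h1 : |B i k| * (K - |y k|) ≤ ∑ m, |B i m| * (K - |y m|) :=
    Finset.single_le_sum (f := fun m => |B i m| * (K - |y m|))
      (fun m _ => mul_nonneg (abs_nonneg _) (sub_nonneg.2 (hK m))) (Finset.mem_univ k)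
  have h2 : ∑ m, |B i m| * (K - |y m|) ≤ ∑ m, (|B i m| * K - σ * (B i m * y m)) :=
    Finset.sum_le_sum fun m _ => by linarith [hterm (B i m) (y m)]
  rw [Finset.sum_sub_distrib, ← Finset.sum_mul, ← Finset.mul_sum] at h2
  rw [sLap_mulVec hB]
  nlinarith [mul_le_mul_of_nonneg_right hR hz]

theorem IsAdjacency.intervalIntegrable_mul {N : ℕ} {A : ℝ → Matrix (Fin N) (Fin N) ℝ}
    (hA : IsAdjacency A) {a b : ℝ} (ha : 0 ≤ a) (hab : a ≤ b) {f : ℝ → ℝ}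
    (hf : ContinuousOn f (Set.Icc a b)) (j k : Fin N) :
    IntervalIntegrable (fun t => A t j k * f t) volume a b := by
  obtain ⟨C, hC⟩ := hA.2.1 b
  have h : IntervalIntegrable (fun t => A t j k) volume a b := by
    rw [intervalIntegrable_iff_integrableOn_Icc_of_le hab]
    refine Measure.integrableOn_of_bounded (M := C) (by simp) (hA.1 j k).aestronglyMeasurable ?_
    filter_upwards [ae_restrict_mem measurableSet_Icc] with t ht
    exact hC t ⟨ha.trans ht.1, ht.2⟩ j k
  exact h.mul_continuousOn (by rwa [Set.uIcc_of_le hab])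

theorem IsSolution.continuousOn_apply {N : ℕ} {A : ℝ → Matrix (Fin N) (Fin N) ℝ}
    {x : ℝ → Fin N → ℝ} (hx : IsSolution A x) {a b : ℝ} (ha : 0 ≤ a) (m : Fin N) :
    ContinuousOn (fun t => x t m) (Set.Icc a b) :=
  ((continuous_apply m).comp_continuousOn hx.1).mono fun _ ht => ha.trans ht.1

theorem IsSolution.intervalIntegrable_sLap {N : ℕ} {A : ℝ → Matrix (Fin N) (Fin N) ℝ}
    {x : ℝ → Fin N → ℝ} (hA : IsAdjacency A) (hx : IsSolution A x)
    {a b : ℝ} (ha : 0 ≤ a) (hab : a ≤ b) (i : Fin N) :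
    IntervalIntegrable (fun s => (sLap (A s)).mulVec (x s) i) volume a b := by
  have hc := fun m => hx.continuousOn_apply (a := a) (b := b) ha m
  simp only [sLap_mulVec (hA.2.2 _), Finset.sum_mul]
  have h1 : ∀ m, IntervalIntegrable (fun s => |A s i m| * x s i) volume a b := by
    intro m
    have h := (hA.intervalIntegrable_mul ha hab continuousOn_const i m (f := fun _ => 1)).abs
    simp only [mul_one] at h
    exact h.mul_continuousOn (by rw [Set.uIcc_of_le hab]; exact hc i)
  have hsum := (IntervalIntegrable.sum Finset.univ fun m _ => h1 m).sub
    (IntervalIntegrable.sum Finset.univ fun m _ => hA.intervalIntegrable_mul ha hab (hc m) i m)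
  simpa only [Finset.sum_fn] using hsum

theorem IsSolution.integral_le_exp_mul_gap {N : ℕ} {A : ℝ → Matrix (Fin N) (Fin N) ℝ}
    {x : ℝ → Fin N → ℝ} (hA : IsAdjacency A) (hx : IsSolution A x)
    {a b R K σ : ℝ} (ha : 0 ≤ a) (hab : a ≤ b)
    (hR : ∀ᵐ t ∂(volume.restrict (Set.Icc a b)), ∀ j, ∑ k, |A t j k| ≤ R)
    (hK : ∀ t ∈ Set.Icc a b, ∀ m, |x t m| ≤ K) (hσ : |σ| = 1) (i k : Fin N) {g : ℝ → ℝ}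
    (hg : IntervalIntegrable g volume a b)
    (hgk : ∀ t ∈ Set.Icc a b,
      g t ≤ Real.exp (R * (t - a)) * (|A t i k| * (K - |x t k|))) :
    ∫ t in a..b, g t ≤
      Real.exp (R * (b - a)) * (K - σ * x b i) - (K - σ * x a i) := by
  refine integral_le_exp_mul_sub (z := fun t => K - σ * x t i)
    (w := fun t => σ * (sLap (A t)).mulVec (x t) i) hab
    ((hx.intervalIntegrable_sLap hA ha hab i).const_mul σ) (fun t ht => ?_) hg ?_
  · have h0t := hx.2 t (ha.trans ht.1) i
    have h0a := hx.2 a ha i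
    have hadd := intervalIntegral.integral_add_adjacent_intervals
      (hx.intervalIntegrable_sLap hA le_rfl ha i) (hx.intervalIntegrable_sLap hA ha ht.1 i)
    rw [intervalIntegral.integral_neg] at h0t h0a
    rw [intervalIntegral.integral_const_mul]
    rw [h0t, h0a, ← hadd]
    ring
  · filter_upwards [hR, ae_restrict_mem measurableSet_Icc] with t hRt ht
    exact (hgk t ht).trans (mul_le_mul_of_nonneg_left
      (abs_mul_gap_le_sLap (hA.2.2 t) hσ (hK t ht) i k (hRt i)) (Real.exp_pos _).le)

theorem IsSolution.gap_le_exp_mul_gap {N : ℕ} {A : ℝ → Matrix (Fin N) (Fin N) ℝ}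
    {x : ℝ → Fin N → ℝ} (hA : IsAdjacency A) (hx : IsSolution A x)
    {a b R K : ℝ} (ha : 0 ≤ a) (hab : a ≤ b)
    (hR : ∀ᵐ t ∂(volume.restrict (Set.Icc a b)), ∀ j, ∑ k, |A t j k| ≤ R)
    (hK : ∀ t ∈ Set.Icc a b, ∀ m, |x t m| ≤ K) (i : Fin N) :
    K - |x a i| ≤ Real.exp (R * (b - a)) * (K - |x b i|) := by
  obtain ⟨σ, hσ, hσx⟩ := exists_abs_eq_one_mul_eq_abs (x b i)
  have h := hx.integral_le_exp_mul_gap hA ha hab hR hK hσ i i (g := fun _ => 0)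
    intervalIntegrable_const fun t ht =>
      mul_nonneg (Real.exp_pos _).le (mul_nonneg (abs_nonneg _) (sub_nonneg.2 (hK t ht i)))
  have h2 : σ * x a i ≤ |x a i| := (le_abs_self _).trans (by simp [abs_mul, hσ])
  rw [hσx, intervalIntegral.integral_zero] at h
  linarith

/-- The sup norm of a solution does not exceed its initial value. -/
theorem IsSolution.norm_le_s9 {N : ℕ} {A : ℝ → Matrix (Fin N) (Fin N) ℝ}
    {x : ℝ → Fin N → ℝ} (hA : IsAdjacency A) (hx : IsSolution A x)
    {a b R : ℝ} (ha : 0 ≤ a)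
    (hR : ∀ᵐ t ∂(volume.restrict (Set.Icc a b)), ∀ j, ∑ k, |A t j k| ≤ R)
    {t : ℝ} (ht : t ∈ Set.Icc a b) : ‖x t‖ ≤ ‖x a‖ := by
  have hc : ContinuousOn (fun t => ‖x t‖) (Set.Icc a b) :=
    (hx.1.mono fun _ ht => ha.trans ht.1).norm
  obtain ⟨τ, hτ, hmax⟩ := isCompact_Icc.exists_isMaxOn ⟨t, ht⟩ hc
  refine (hmax ht).trans ?_
  by_contra! hlt
  have hex : ¬ ∀ i, ‖x τ i‖ < ‖x τ‖ := fun h =>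
    lt_irrefl _ ((pi_norm_lt_iff ((norm_nonneg _).trans_lt hlt)).2 h)
  push Not at hex
  obtain ⟨i, hi⟩ := hex
  have h := hx.gap_le_exp_mul_gap hA ha hτ.1
    (ae_mono (Measure.restrict_mono (Set.Icc_subset_Icc_right hτ.2) le_rfl) hR)
    (fun s hs m => (norm_le_pi_norm (x s) m).trans (hmax ⟨hs.1, hs.2.trans hτ.2⟩)) i
  have hle := norm_le_pi_norm (x a) i
  rw [Real.norm_eq_abs] at hi hle
  have := mul_nonpos_of_nonneg_of_nonpos (Real.exp_pos (R * (τ - a))).le (sub_nonpos.2 hi)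
  simp only at h
  linarith

theorem exists_arc_into_of_reflTransGen {α : Type*} {r : α → α → Prop} {V : Set α}
    (hr : ∀ u v, Relation.ReflTransGen r u v) (hVne : V.Nonempty) (hVproper : V ≠ Set.univ) :
    ∃ k ∉ V, ∃ j ∈ V, r k j := by
  obtain ⟨v, hv⟩ := hVne
  obtain ⟨u, hu⟩ := (Set.ne_univ_iff_exists_notMem V).1 hVproper
  by_contra! hcon
  have hstay : ∀ w, Relation.ReflTransGen r u w → w ∉ V := by
    intro w hw
    induction hw with
    | refl => exact hu
    | tail _ hbc ih => exact fun hc => hcon _ ih _ hc hbc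
  exact hstay v (hr u v) hv

theorem mul_sub_nonneg_of_ae_sum_abs_le {N : ℕ} {A : ℝ → Matrix (Fin N) (Fin N) ℝ}
    {a b R : ℝ} (hab : a ≤ b) (j : Fin N)
    (hR : ∀ᵐ t ∂(volume.restrict (Set.Icc a b)), ∀ j, ∑ k, |A t j k| ≤ R) :
    0 ≤ R * (b - a) := by
  rcases hab.eq_or_lt with rfl | hlt
  · simp
  · have : NeZero (volume.restrict (Set.Icc a b)) :=
      ⟨by simp [Measure.restrict_eq_zero, Real.volume_Icc, hlt]⟩
    obtain ⟨t, ht⟩ := hR.exists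
    exact mul_nonneg ((Finset.sum_nonneg fun k _ => abs_nonneg _).trans (ht j))
      (sub_nonneg.2 hab)

/-- under the bound `|A(t)|_∞ ≤ R` a.e. on `[t₀,t₁]`, strong `ε`-connectivity of
the graph of `∫_{t₀}^{t₁} |a_{jk}(t)| dt`, and `θ = ε θ₀² < 1`, for any nonempty proper `V`
there is `k ∈ V` with `|x_k(t₁)| ≤ θ M′ + (1 − θ) M`, where `M = |x(t₀)|_∞` and
`M′ = max_{j∉V} |x_j(t₀)|`. -/
theorem stmt9 {N : ℕ} (hN : 2 ≤ N) (A : ℝ → Matrix (Fin N) (Fin N) ℝ)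
    (hA : IsAdjacency A) (x : ℝ → Fin N → ℝ) (hx : IsSolution A x)
    (t0 t1 R ε : ℝ) (h0 : 0 ≤ t0) (h01 : t0 ≤ t1) (hε : 0 < ε)
    (hR : ∀ᵐ t ∂(volume.restrict (Set.Icc t0 t1)), ∀ j, ∑ k, |A t j k| ≤ R)
    (hconn : ∀ u v : Fin N,
      Relation.ReflTransGen (fun k j => ε ≤ ∫ t in t0..t1, |A t j k|) u v)
    (hθ : ε * Real.exp (-R * (t1 - t0)) ^ 2 < 1)
    (V : Set (Fin N)) (hVne : V.Nonempty) (hVproper : V ≠ Set.univ)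
    (M' : ℝ) (hM' : IsGreatest ((fun j => |x t0 j|) '' Vᶜ) M') :
    ∃ k ∈ V, |x t1 k| ≤ ε * Real.exp (-R * (t1 - t0)) ^ 2 * M'
      + (1 - ε * Real.exp (-R * (t1 - t0)) ^ 2) * ‖x t0‖ := by
  obtain ⟨k, hkV, j, hjV, harc⟩ := exists_arc_into_of_reflTransGen hconn hVne hVproper
  refine ⟨j, hjV, ?_⟩
  have hnorm : ∀ t ∈ Set.Icc t0 t1, ∀ m, |x t m| ≤ ‖x t0‖ := fun t ht m =>
    (norm_le_pi_norm (x t) m).trans (hx.norm_le_s9 hA h0 hR ht)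
  have hM'le : M' ≤ ‖x t0‖ := by
    obtain ⟨l, -, hl⟩ := hM'.1
    exact hl.symm.le.trans (norm_le_pi_norm (x t0) l)
  have hgap : ∀ t ∈ Set.Icc t0 t1,
      ‖x t0‖ - M' ≤ Real.exp (R * (t - t0)) * (‖x t0‖ - |x t k|) := by
    intro t ht
    have h := hx.gap_le_exp_mul_gap hA h0 ht.1
      (ae_mono (Measure.restrict_mono (Set.Icc_subset_Icc_right ht.2) le_rfl) hR)
      (fun s hs => hnorm s ⟨hs.1, hs.2.trans ht.2⟩) k
    have : |x t0 k| ≤ M' := hM'.2 ⟨k, hkV, rfl⟩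
    linarith
  have habs : IntervalIntegrable (fun t => |A t j k|) volume t0 t1 := by
    simpa using
      (hA.intervalIntegrable_mul h0 h01 continuousOn_const j k (f := fun _ => 1)).abs
  obtain ⟨σ, hσ, hσx⟩ := exists_abs_eq_one_mul_eq_abs (x t1 j)
  have hmain := hx.integral_le_exp_mul_gap hA h0 h01 hR hnorm hσ j k
    (habs.mul_const (‖x t0‖ - M')) fun t ht => by
      calc |A t j k| * (‖x t0‖ - M')
          ≤ |A t j k| * (Real.exp (R * (t - t0)) * (‖x t0‖ - |x t k|)) :=
            mul_le_mul_of_nonneg_left (hgap t ht) (abs_nonneg _)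
        _ = _ := by ring
  rw [intervalIntegral.integral_mul_const, hσx] at hmain
  have hinit : σ * x t0 j ≤ ‖x t0‖ :=
    (le_abs_self _).trans (by simpa [abs_mul, hσ] using norm_le_pi_norm (x t0) j)
  have hD := sub_nonneg.2 hM'le
  have hε' := mul_le_mul_of_nonneg_right harc hD
  set E := Real.exp (-R * (t1 - t0)) with hE
  have hE0 : 0 < E := Real.exp_pos _
  have hE1 : E ≤ 1 := Real.exp_le_one_iff.2 (by
    linarith [mul_sub_nonneg_of_ae_sum_abs_le h01 j hR])
  have hEE : E * Real.exp (R * (t1 - t0)) = 1 := by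
    rw [hE, ← Real.exp_add]
    simp
  have h1 : E * (ε * (‖x t0‖ - M')) ≤ ‖x t0‖ - |x t1 j| := by
    calc E * (ε * (‖x t0‖ - M'))
        ≤ E * (Real.exp (R * (t1 - t0)) * (‖x t0‖ - |x t1 j|)) :=
          mul_le_mul_of_nonneg_left (by linarith) hE0.le
      _ = _ := by rw [← mul_assoc, hEE, one_mul]
  have h2 : E * (E * (ε * (‖x t0‖ - M'))) ≤ E * (ε * (‖x t0‖ - M')) :=
    mul_le_of_le_one_left (mul_nonneg hE0.le (mul_nonneg hε.le hD)) hE1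
  linarith
end

section
/- Suppose a_{jk}(t) ≥ 0 for all j,k and almost all t ≥ 0, the entries a_{jk}(t) are bounded, and the time-varying graph G[A(·)] is uniformly strongly connected. Then the protocol ẋ(t) = −L[A(t)]x(t) establishes consensus: for every solution x there exists c ∈ ℝ such that lim_{t→∞} x_i(t) = c for every i ∈ {1,…,N}. -/
open MeasureTheory Filter Matrix Finset Topology

theorem exp_mul_sub_exp_mul_eq_integral {y f : ℝ → ℝ} {K s t : ℝ} (hst : s ≤ t)
    (hf : IntervalIntegrable f volume s t)
    (hy : ∀ τ ∈ Set.Icc s t, y τ = y s + ∫ r in s..τ, f r) :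
    Real.exp (K * t) * y t - Real.exp (K * s) * y s =
      ∫ τ in s..t, Real.exp (K * τ) * (f τ + K * y τ) := by
  have hY : AbsolutelyContinuousOnInterval (fun τ => y s + ∫ r in s..τ, f r) s t := by
    refine AbsolutelyContinuousOnInterval.fun_add ?_
      (hf.absolutelyContinuousOnInterval_intervalIntegral (by simp))
    exact (LipschitzWith.const (y s)).lipschitzOnWith.absolutelyContinuousOnInterval
  have hE : AbsolutelyContinuousOnInterval (fun τ => Real.exp (K * τ)) s t := by
    apply ContDiffOn.absolutelyContinuousOnInterval
    fun_prop
  have key := hE.integral_deriv_mul_eq_sub hY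
  rw [← hy t (Set.right_mem_Icc.2 hst), ← hy s (Set.left_mem_Icc.2 hst)] at key
  rw [← key]
  apply intervalIntegral.integral_congr_ae
  filter_upwards [hf.ae_hasDerivAt_integral] with τ hτ hmem
  have hmem' : τ ∈ Set.uIcc s t := Set.uIoc_subset_uIcc hmem
  have h1 : deriv (fun τ => y s + ∫ r in s..τ, f r) τ = f τ :=
    ((hτ hmem' s (by simp)).const_add _).deriv
  have h2 : deriv (fun τ => Real.exp (K * τ)) τ = Real.exp (K * τ) * K := by
    simpa using (((hasDerivAt_id τ).const_mul K).exp).deriv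
  rw [h1, h2, ← hy τ (by rwa [Set.uIcc_of_le hst] at hmem')]
  ring

/-- `z` solves the linear system `ż = B(t) z` on `[0,∞)`, in integral form, where `B` is
measurable, bounded by `b`, and almost everywhere entrywise nonnegative. -/
structure IsPositiveSystem {ι : Type*} [Fintype ι] (B : ℝ → ι → ι → ℝ) (b : ℝ)
    (z : ℝ → ι → ℝ) : Prop where
  measurable : ∀ j k, Measurable fun t => B t j k
  bound : ∀ t, 0 ≤ t → ∀ j k, |B t j k| ≤ b
  nonneg : ∀ᵐ t, 0 ≤ t → ∀ j k, 0 ≤ B t j k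
  continuous : Continuous z
  sub_eq : ∀ s t, 0 ≤ s → s ≤ t → ∀ j,
    z t j - z s j = ∫ τ in s..t, ∑ k, B τ j k * z τ k

theorem intervalIntegrable_of_bound {g : ℝ → ℝ} {b s t : ℝ} (hg : Measurable g)
    (hb : ∀ τ, 0 ≤ τ → |g τ| ≤ b) (hs : 0 ≤ s) (hst : s ≤ t) :
    IntervalIntegrable g volume s t := by
  rw [intervalIntegrable_iff_integrableOn_Ioc_of_le hst]
  refine Measure.integrableOn_of_bounded (M := b) (by simp) hg.aestronglyMeasurable ?_
  filter_upwards [ae_restrict_mem measurableSet_Ioc] with τ hτ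
  exact hb τ (hs.trans hτ.1.le)

namespace IsPositiveSystem

variable {ι : Type*} [Fintype ι] {B : ℝ → ι → ι → ℝ} {b : ℝ} {z : ℝ → ι → ℝ}

theorem intervalIntegrable (h : IsPositiveSystem B b z) {s t : ℝ} (hs : 0 ≤ s) (hst : s ≤ t)
    (j k : ι) : IntervalIntegrable (fun τ => B τ j k) volume s t :=
  intervalIntegrable_of_bound (h.measurable j k) (fun τ hτ => h.bound τ hτ j k) hs hst

theorem intervalIntegrable_mul (h : IsPositiveSystem B b z) {s t : ℝ} (hs : 0 ≤ s)
    (hst : s ≤ t) (j k : ι) : IntervalIntegrable (fun τ => B τ j k * z τ k) volume s t :=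
  (h.intervalIntegrable hs hst j k).mul_continuousOn
    ((continuous_apply k).comp h.continuous).continuousOn

theorem intervalIntegrable_sum (h : IsPositiveSystem B b z) {s t : ℝ} (hs : 0 ≤ s)
    (hst : s ≤ t) (j : ι) : IntervalIntegrable (fun τ => ∑ k, B τ j k * z τ k) volume s t := by
  have := IntervalIntegrable.sum (μ := volume) (a := s) (b := t) Finset.univ
    (f := fun k τ => B τ j k * z τ k) (fun k _ => h.intervalIntegrable_mul hs hst j k)
  simpa [Finset.sum_fn] using this

theorem ae_nonneg_of_mem (h : IsPositiveSystem B b z) {s t : ℝ} (hs : 0 ≤ s) :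
    ∀ᵐ τ ∂(volume.restrict (Set.Icc s t)), τ ∈ Set.Icc s t ∧ ∀ j k, 0 ≤ B τ j k := by
  filter_upwards [ae_restrict_mem measurableSet_Icc, ae_restrict_of_ae h.nonneg] with τ h1 h2
  exact ⟨h1, h2 (hs.trans h1.1)⟩

/-- The nonnegative orthant is forward invariant. -/
theorem nonneg_of_nonneg (h : IsPositiveSystem B b z) {s : ℝ} (hs : 0 ≤ s)
    (h0 : ∀ j, 0 ≤ z s j) {t : ℝ} (hst : s ≤ t) (j : ι) : 0 ≤ z t j := by
  classical
  have hb : 0 ≤ b := (abs_nonneg _).trans (h.bound s hs j j)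
  set w : ℝ → ℝ := fun τ => ∑ k, max (-z τ k) 0 with hw
  have hwc : Continuous w := by
    refine continuous_finsetSum _ fun k _ => ?_
    exact (((continuous_apply k).comp h.continuous).neg).max continuous_const
  have hw0 : ∀ τ, 0 ≤ w τ := fun τ => Finset.sum_nonneg fun k _ => le_max_right _ _
  have hint0 : ∀ τ, s ≤ τ → 0 ≤ ∫ r in s..τ, w r := fun τ hτ =>
    intervalIntegral.integral_nonneg hτ fun r _ => hw0 r
  have hlow : ∀ τ, s ≤ τ → ∀ i, -z τ i ≤ b * ∫ r in s..τ, w r := by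
    intro τ hτ i
    have h1 := h.sub_eq s τ hs hτ i
    have h2 : (∫ r in s..τ, -(b * w r)) ≤ ∫ r in s..τ, ∑ k, B r i k * z r k := by
      refine intervalIntegral.integral_mono_ae_restrict hτ ?_ (h.intervalIntegrable_sum hs hτ i) ?_
      · exact ((hwc.const_mul b).neg).intervalIntegrable _ _
      · filter_upwards [h.ae_nonneg_of_mem (t := τ) hs] with r hr
        rw [hw, Finset.mul_sum, ← Finset.sum_neg_distrib]
        refine Finset.sum_le_sum fun k _ => ?_
        have hB := hr.2 i k
        have hBb := (le_abs_self _).trans (h.bound r (hs.trans hr.1.1) i k)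
        have h3 : -z r k ≤ max (-z r k) 0 := le_max_left _ _
        have h4 : 0 ≤ max (-z r k) 0 := le_max_right _ _
        nlinarith [mul_le_mul_of_nonneg_left h3 hB, mul_le_mul_of_nonneg_right hBb h4]
    rw [intervalIntegral.integral_neg, intervalIntegral.integral_const_mul] at h2
    linarith [h0 i]
  have hwle : ∀ τ, s ≤ τ → w τ ≤ (Fintype.card ι * b) * ∫ r in s..τ, w r := by
    intro τ hτ
    calc w τ ≤ ∑ _k : ι, b * ∫ r in s..τ, w r :=
          Finset.sum_le_sum fun k _ => max_le (hlow τ hτ k) (mul_nonneg hb (hint0 τ hτ))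
      _ = _ := by simp [mul_assoc]
  have hder : ∀ τ, HasDerivAt (fun τ => ∫ r in s..τ, w r) (w τ) τ := fun τ =>
    intervalIntegral.integral_hasDerivAt_right (hwc.intervalIntegrable _ _)
      (hwc.stronglyMeasurableAtFilter _ _) hwc.continuousAt
  have hgr := norm_le_gronwallBound_of_norm_deriv_right_le (f := fun τ => ∫ r in s..τ, w r)
    (f' := w) (δ := 0) (K := Fintype.card ι * b) (ε := 0) (a := s) (b := t)
    (fun τ _ => (hder τ).continuousAt.continuousWithinAt)
    (fun τ _ => (hder τ).hasDerivWithinAt) (by simp)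
    (fun τ hτ => by
      rw [Real.norm_of_nonneg (hw0 τ), Real.norm_of_nonneg (hint0 τ hτ.1), add_zero]
      exact hwle τ hτ.1) t ⟨hst, le_rfl⟩
  rw [gronwallBound_ε0_δ0, Real.norm_of_nonneg (hint0 t hst)] at hgr
  have := hlow t hst j
  nlinarith [hint0 t hst]

/-- Along a nonnegative solution, each coordinate grows at least by the contribution of any
single arc weighted by the initial value at its tail. -/
theorem add_mul_integral_le (h : IsPositiveSystem B b z) {s t : ℝ} (hs : 0 ≤ s)
    (h0 : ∀ j, 0 ≤ z s j) (hst : s ≤ t) (j k : ι) {p : ℝ}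
    (hp : ∀ τ ∈ Set.Icc s t, p ≤ z τ k) :
    z s j + p * ∫ τ in s..t, B τ j k ≤ z t j := by
  have h1 := h.sub_eq s t hs hst j
  have h2 : (∫ τ in s..t, p * B τ j k) ≤ ∫ τ in s..t, ∑ i, B τ j i * z τ i := by
    refine intervalIntegral.integral_mono_ae_restrict hst
      ((h.intervalIntegrable hs hst j k).const_mul p) (h.intervalIntegrable_sum hs hst j) ?_
    filter_upwards [h.ae_nonneg_of_mem (t := t) hs] with τ hτ
    calc p * B τ j k ≤ B τ j k * z τ k := by
          rw [mul_comm]; exact mul_le_mul_of_nonneg_left (hp τ hτ.1) (hτ.2 j k)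
      _ ≤ _ := Finset.single_le_sum (f := fun i => B τ j i * z τ i)
          (fun i _ => mul_nonneg (hτ.2 j i) (h.nonneg_of_nonneg hs h0 hτ.1.1 i))
          (Finset.mem_univ k)
  rw [intervalIntegral.integral_const_mul] at h2
  linarith

theorem le_of_nonneg (h : IsPositiveSystem B b z) {s t : ℝ} (hs : 0 ≤ s)
    (h0 : ∀ j, 0 ≤ z s j) (hst : s ≤ t) (j : ι) : z s j ≤ z t j := by
  simpa using h.add_mul_integral_le hs h0 hst j j (p := 0)
    fun τ hτ => h.nonneg_of_nonneg hs h0 hτ.1 j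

end IsPositiveSystem

theorem Relation.ReflTransGen.exists_mem_notMem {α : Type*} {r : α → α → Prop} {u v : α}
    (h : Relation.ReflTransGen r u v) {S : Set α} (hu : u ∈ S) (hv : v ∉ S) :
    ∃ k ∈ S, ∃ j ∉ S, r k j := by
  induction h with
  | refl => exact absurd hu hv
  | @tail c d _ hcd ih =>
    by_cases hc : c ∈ S
    · exact ⟨c, hc, d, hv, hcd⟩
    · exact ih hc

namespace IsPositiveSystem

variable {ι : Type*} [Fintype ι] {B : ℝ → ι → ι → ℝ} {b : ℝ} {z : ℝ → ι → ℝ}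

/-- If in every window of length `T` the arcs of weight at least `ε` connect the graph strongly,
then a positive value at one node spreads to all nodes in `card ι` windows. -/
theorem pow_mul_le (h : IsPositiveSystem B b z) {T ε q : ℝ} (hT : 0 ≤ T) (hq0 : 0 ≤ q)
    (hq1 : q ≤ 1) (hqε : q ≤ ε)
    (hconn : ∀ t, 0 ≤ t → ∀ S : Set ι, S.Nonempty → S ≠ Set.univ →
      ∃ k ∈ S, ∃ j ∉ S, ε ≤ ∫ τ in t..(t + T), B τ j k)
    {s : ℝ} (hs : 0 ≤ s) (h0 : ∀ j, 0 ≤ z s j) (i j : ι) :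
    q ^ Fintype.card ι * z s i ≤ z (s + Fintype.card ι * T) j := by
  classical
  have key : ∀ n : ℕ, ∃ S : Finset ι, i ∈ S ∧ min (n + 1) (Fintype.card ι) ≤ S.card ∧
      ∀ k ∈ S, q ^ n * z s i ≤ z (s + n * T) k := by
    intro n
    induction n with
    | zero => exact ⟨{i}, by simp, by simp, by simp⟩
    | succ n ih =>
      obtain ⟨S, hiS, hcard, hS⟩ := ih
      have hsn : s ≤ s + n * T := le_add_of_nonneg_right (by positivity)
      have hz : ∀ k, 0 ≤ z (s + n * T) k := h.nonneg_of_nonneg hs h0 hsn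
      have hs' : 0 ≤ s + n * T := hs.trans hsn
      have heq : s + (n + 1 : ℕ) * T = s + n * T + T := by push_cast; ring
      have hle : s + n * T ≤ s + n * T + T := by linarith
      have hP : 0 ≤ q ^ n * z s i := mul_nonneg (pow_nonneg hq0 n) (h0 i)
      have hkeep : ∀ k ∈ S, q ^ (n + 1) * z s i ≤ z (s + n * T + T) k := fun k hk => by
        have h1 := h.le_of_nonneg hs' hz hle k
        have h2 := hS k hk
        rw [pow_succ]
        nlinarith
      rw [heq]
      by_cases hSu : S = Finset.univ
      · refine ⟨S, hiS, ?_, hkeep⟩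
        rw [hSu, Finset.card_univ]
        exact min_le_right _ _
      · obtain ⟨k, hk, j, hj, hkj⟩ := hconn (s + n * T) hs' S ⟨i, by simpa using hiS⟩
          (by simpa using hSu)
        refine ⟨insert j S, Finset.mem_insert_of_mem hiS, ?_, ?_⟩
        · rw [Finset.card_insert_of_notMem (by simpa using hj)]
          omega
        · intro l hl
          rcases Finset.mem_insert.1 hl with rfl | hl
          · have h1 := h.add_mul_integral_le hs' hz hle l k (p := q ^ n * z s i)
              fun τ hτ => (hS k (by simpa using hk)).trans
                (h.le_of_nonneg hs' hz hτ.1 k)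
            have h2 := hz l
            have h3 := mul_le_mul_of_nonneg_left (hqε.trans hkj) hP
            rw [pow_succ]
            linarith
          · exact hkeep l hl
  obtain ⟨S, -, hcard, hS⟩ := key (Fintype.card ι)
  have hSu : S = Finset.univ := by
    rw [← Finset.card_eq_iff_eq_univ]
    have := Finset.card_le_univ S
    omega
  exact hS j (by simp [hSu])

end IsPositiveSystem

theorem IsSolution.isPositiveSystem {N : ℕ} {A : ℝ → Matrix (Fin N) (Fin N) ℝ}
    {x : ℝ → Fin N → ℝ} {R : ℝ} (hx : IsSolution A x) (hA : IsAdjacency A)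
    (hpos : ∀ᵐ t ∂(volume.restrict (Set.Ici (0:ℝ))), ∀ j k, 0 ≤ A t j k)
    (hR : ∀ t ≥ (0:ℝ), ∀ j k, |A t j k| ≤ R) (σ c : ℝ) :
    IsPositiveSystem (fun t j k => A t j k + if j = k then N * R - ∑ m, |A t j m| else 0)
      (R + N * R) (fun t j => Real.exp (N * R * t) * (σ * x (max t 0) j + c)) := by
  obtain ⟨hmeas, -, hdiag⟩ := hA
  rw [ae_restrict_iff' measurableSet_Ici] at hpos
  have hsum : ∀ t, 0 ≤ t → ∀ j, ∑ m, |A t j m| ≤ N * R := fun t ht j => by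
    calc ∑ m, |A t j m| ≤ ∑ _m : Fin N, R := Finset.sum_le_sum fun m _ => hR t ht j m
      _ = N * R := by simp
  have hxc : Continuous fun t => x (max t 0) := by
    refine hx.1.comp_continuous (continuous_id.max continuous_const) fun t =>
      Set.mem_Ici.2 (le_max_right _ _)
  set f : Fin N → ℝ → ℝ := fun j s => -((sLap (A s)).mulVec (x (max s 0)) j) with hf
  have hfx : ∀ j s, f j s = ∑ k, A s j k * x (max s 0) k - (∑ m, |A s j m|) * x (max s 0) j := by
    intro j s
    have : ∀ k, sLap (A s) j k * x (max s 0) k =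
        (if j = k then (∑ m, |A s j m|) * x (max s 0) k else 0) - A s j k * x (max s 0) k := by
      intro k
      rcases eq_or_ne j k with rfl | hjk
      · simp [sLap, hdiag]
      · simp [sLap, hjk]
    simp only [hf, Matrix.mulVec, dotProduct, this, Finset.sum_sub_distrib, Finset.sum_ite_eq,
      Finset.mem_univ, if_true, neg_sub]
  have hfi : ∀ j s t, 0 ≤ s → s ≤ t → IntervalIntegrable (f j) volume s t := by
    intro j s t hs hst
    have hint : ∀ k, IntervalIntegrable (fun τ => A τ j k) volume s t := fun k =>
      intervalIntegrable_of_bound (hmeas j k) (fun τ hτ => hR τ hτ j k) hs hst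
    have hcont : ∀ k, ContinuousOn (fun τ => x (max τ 0) k) (Set.uIcc s t) := fun k =>
      ((continuous_apply k).comp hxc).continuousOn
    have h1 := IntervalIntegrable.sum (μ := volume) (a := s) (b := t) Finset.univ
      (f := fun k τ => A τ j k * x (max τ 0) k) fun k _ => (hint k).mul_continuousOn (hcont k)
    have h2 := IntervalIntegrable.sum (μ := volume) (a := s) (b := t) Finset.univ
      (f := fun k τ => |A τ j k|) fun k _ => (hint k).abs
    have h3 := h1.sub (h2.mul_continuousOn (hcont j))
    convert h3 using 1
    funext τ
    simp [hfx]
  have hxe : ∀ j s, 0 ≤ s → x s j = x 0 j + ∫ r in (0:ℝ)..s, f j r := by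
    intro j s hs
    rw [hx.2 s hs j]
    congr 1
    refine intervalIntegral.integral_congr fun r hr => ?_
    rw [Set.uIcc_of_le hs] at hr
    simp [hf, max_eq_left hr.1]
  refine ⟨fun j k => ?_, fun t ht j k => ?_, ?_, ?_, fun s t hs hst j => ?_⟩
  · refine (hmeas j k).add ?_
    split_ifs
    · exact measurable_const.sub (Finset.measurable_sum _ fun m _ => (hmeas j m).abs)
    · exact measurable_const
  · have h0 : 0 ≤ ∑ m, |A t j m| := Finset.sum_nonneg fun m _ => abs_nonneg _
    have h1 := hsum t ht j
    refine (abs_add_le _ _).trans (add_le_add (hR t ht j k) ?_)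
    split_ifs
    · rw [abs_of_nonneg (by linarith)]
      linarith
    · rw [abs_zero]
      linarith
  · filter_upwards [hpos] with t ht h0 j k
    refine add_nonneg (ht h0 j k) ?_
    split_ifs
    · linarith [hsum t h0 j]
    · exact le_rfl
  · refine continuous_pi fun j => ?_
    have := (continuous_apply j).comp hxc
    exact (Real.continuous_exp.comp (continuous_const.mul continuous_id)).mul
      ((continuous_const.mul this).add continuous_const)
  · have key := exp_mul_sub_exp_mul_eq_integral (K := N * R)
      (y := fun τ => σ * x (max τ 0) j + c) (f := fun τ => σ * f j τ) hst
      ((hfi j s t hs hst).const_mul σ) (fun τ hτ => by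
        have hτ0 := hs.trans hτ.1
        have hadd := intervalIntegral.integral_add_adjacent_intervals
          (hfi j 0 s le_rfl hs) (hfi j s τ hs hτ.1)
        simp only [intervalIntegral.integral_const_mul, max_eq_left hs, max_eq_left hτ0]
        rw [hxe j τ hτ0, hxe j s hs, ← hadd]
        ring)
    rw [key]
    refine intervalIntegral.integral_congr_ae ?_
    filter_upwards [hpos] with τ hτ hmem
    rw [Set.uIoc_of_le hst] at hmem
    have hn := hτ (hs.trans hmem.1.le) j
    have habs : ∑ m, |A τ j m| = ∑ m, A τ j m :=
      Finset.sum_congr rfl fun m _ => abs_of_nonneg (hn m)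
    have e1 : ∀ k, (A τ j k + if j = k then N * R - ∑ m, |A τ j m| else 0) *
        (Real.exp (N * R * τ) * (σ * x (max τ 0) k + c)) =
        Real.exp (N * R * τ) * (σ * (A τ j k * x (max τ 0) k) + c * A τ j k) +
        if j = k then (N * R - ∑ m, |A τ j m|) *
          (Real.exp (N * R * τ) * (σ * x (max τ 0) k + c)) else 0 := by
      intro k
      split_ifs <;> ring
    refine Eq.trans ?_ (Finset.sum_congr rfl fun k _ => e1 k).symm
    simp only [Finset.sum_add_distrib, Finset.sum_ite_eq, Finset.mem_univ, if_true,
      ← Finset.mul_sum, hfx, habs]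
    ring

theorem USC.exists_arc {N : ℕ} {A : ℝ → Matrix (Fin N) (Fin N) ℝ}
    (hpos : ∀ᵐ t ∂(volume.restrict (Set.Ici (0:ℝ))), ∀ j k, 0 ≤ A t j k) {T ε : ℝ} (hT : 0 < T)
    (hconn : ∀ t ≥ (0:ℝ), ∀ u v : Fin N,
      Relation.ReflTransGen (fun k j => ε ≤ ∫ s in t..(t + T), |A s j k|) u v)
    (d : ℝ → Fin N → ℝ) {t : ℝ} (ht : 0 ≤ t) {S : Set (Fin N)} (hS : S.Nonempty)
    (hSu : S ≠ Set.univ) :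
    ∃ k ∈ S, ∃ j ∉ S,
      ε ≤ ∫ s in t..(t + T), (A s j k + if j = k then d s j else 0) := by
  obtain ⟨u, hu⟩ := hS
  obtain ⟨v, hv⟩ := (Set.ne_univ_iff_exists_notMem S).1 hSu
  obtain ⟨k, hk, j, hj, hkj⟩ := (hconn t ht u v).exists_mem_notMem hu hv
  refine ⟨k, hk, j, hj, hkj.trans_eq ?_⟩
  have hne : j ≠ k := fun h => hj (h ▸ hk)
  rw [ae_restrict_iff' measurableSet_Ici] at hpos
  refine intervalIntegral.integral_congr_ae ?_
  filter_upwards [hpos] with s hs hmem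
  rw [Set.uIoc_of_le (by linarith)] at hmem
  simp [hne, abs_of_nonneg (hs (ht.trans hmem.1.le) j k)]

/-- If the spread `M - m` of nested intervals `[m t, M t]` contracts by a fixed factor over every
window of length `τ`, then everything trapped in these intervals converges to a common limit. -/
theorem exists_tendsto_of_contracting_intervals {ι : Type*} {x : ℝ → ι → ℝ} {m M : ℝ → ℝ}
    {τ θ : ℝ} (hτ : 0 ≤ τ) (hθ0 : 0 ≤ θ) (hθ1 : θ < 1)
    (hmM : ∀ t, 0 ≤ t → m t ≤ M t)
    (hm : ∀ s t, 0 ≤ s → s ≤ t → m s ≤ m t) (hM : ∀ s t, 0 ≤ s → s ≤ t → M t ≤ M s)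
    (hxm : ∀ t, 0 ≤ t → ∀ i, m t ≤ x t i) (hxM : ∀ t, 0 ≤ t → ∀ i, x t i ≤ M t)
    (hcontr : ∀ t, 0 ≤ t → M (t + τ) - m (t + τ) ≤ θ * (M t - m t)) :
    ∃ c : ℝ, ∀ i, Tendsto (fun t => x t i) atTop (𝓝 c) := by
  have hcross : ∀ s t, 0 ≤ s → 0 ≤ t → m s ≤ M t := fun s t hs ht =>
    (hm s (max s t) hs (le_max_left _ _)).trans
      ((hmM _ (hs.trans (le_max_left _ _))).trans (hM t _ ht (le_max_right _ _)))
  have hbdd : BddAbove (m '' Set.Ici 0) := ⟨M 0, by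
    rintro _ ⟨s, hs, rfl⟩; exact hcross s 0 hs le_rfl⟩
  have hc1 : ∀ t, 0 ≤ t → m t ≤ sSup (m '' Set.Ici 0) := fun t ht =>
    le_csSup hbdd ⟨t, ht, rfl⟩
  have hc2 : ∀ t, 0 ≤ t → sSup (m '' Set.Ici 0) ≤ M t := fun t ht =>
    csSup_le ⟨m 0, 0, Set.self_mem_Ici, rfl⟩ (by rintro _ ⟨s, hs, rfl⟩; exact hcross s t hs ht)
  have hgeom : ∀ n : ℕ, M (n * τ) - m (n * τ) ≤ θ ^ n * (M 0 - m 0) := by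
    intro n
    induction n with
    | zero => simp
    | succ n ih =>
      have h1 := hcontr (n * τ) (by positivity)
      have h2 : ((n + 1 : ℕ) : ℝ) * τ = n * τ + τ := by push_cast; ring
      rw [h2, pow_succ']
      nlinarith [mul_le_mul_of_nonneg_left ih hθ0]
  refine ⟨sSup (m '' Set.Ici 0), fun i => Metric.tendsto_atTop.2 fun ε hε => ?_⟩
  have hlim : Tendsto (fun n : ℕ => θ ^ n * (M 0 - m 0)) atTop (𝓝 0) := by
    simpa using (tendsto_pow_atTop_nhds_zero_of_lt_one hθ0 hθ1).mul_const (M 0 - m 0)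
  obtain ⟨n, hn⟩ := (hlim.eventually (gt_mem_nhds hε)).exists
  have hn0 : 0 ≤ n * τ := by positivity
  refine ⟨n * τ, fun t ht => ?_⟩
  have ht0 := hn0.trans ht
  have h1 := hm _ t hn0 ht
  have h2 := hM _ t hn0 ht
  have h3 := hgeom n
  rw [Real.dist_eq, abs_lt]
  constructor <;> linarith [hc1 t ht0, hc2 t ht0, hxm t ht0 i, hxM t ht0 i]

/-- for nonnegative bounded weights, uniform strong connectivity implies
consensus. -/
theorem stmt11 {N : ℕ} (hN : 2 ≤ N) (A : ℝ → Matrix (Fin N) (Fin N) ℝ)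
    (hA : IsAdjacency A)
    (hpos : ∀ᵐ t ∂(volume.restrict (Set.Ici (0:ℝ))), ∀ j k, 0 ≤ A t j k)
    (hbdd : ∃ R : ℝ, ∀ t ≥ (0:ℝ), ∀ j k, |A t j k| ≤ R)
    (hUSC : USC A) :
    ∀ x : ℝ → Fin N → ℝ, IsSolution A x →
      ∃ c : ℝ, ∀ i, Tendsto (fun t => x t i) atTop (𝓝 c) := by
  intro x hx
  obtain ⟨R, hR⟩ := hbdd
  obtain ⟨T, hT, ε, hε, hconn⟩ := hUSC
  have : Nonempty (Fin N) := ⟨⟨0, by omega⟩⟩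
  have hR0 : 0 ≤ R := (abs_nonneg _).trans (hR 0 le_rfl (Classical.arbitrary _)
    (Classical.arbitrary _))
  set q : ℝ := min 1 ε with hq
  have hq0 : 0 < q := lt_min one_pos hε
  have hq1 : q ≤ 1 := min_le_left _ _
  set η : ℝ := q ^ N * Real.exp (-(N * R * (N * T))) with hη
  have hη0 : 0 < η := by positivity
  have hη1 : η ≤ 1 := mul_le_one₀ (pow_le_one₀ hq0.le hq1) (Real.exp_pos _).le
    (Real.exp_le_one_iff.2 (neg_nonpos.2 (by positivity)))
  have hsys := fun σ c => hx.isPositiveSystem hA hpos hR σ c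
  have hz : ∀ σ c s, (∀ j, 0 ≤ σ * x s j + c) → 0 ≤ s →
      ∀ j, 0 ≤ Real.exp (N * R * s) * (σ * x (max s 0) j + c) := fun σ c s h0 hs j => by
    rw [max_eq_left hs]
    exact mul_nonneg (Real.exp_pos _).le (h0 j)
  have hinv : ∀ σ c s t, 0 ≤ s → s ≤ t → (∀ j, 0 ≤ σ * x s j + c) →
      ∀ j, 0 ≤ σ * x t j + c := by
    intro σ c s t hs hst h0 j
    have h1 := (hsys σ c).nonneg_of_nonneg hs (hz σ c s h0 hs) hst j
    rw [max_eq_left (hs.trans hst)] at h1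
    exact nonneg_of_mul_nonneg_right h1 (Real.exp_pos _)
  have hspread : ∀ c s, 0 ≤ s → (∀ j, 0 ≤ x s j + c) →
      ∀ i j, η * (x s i + c) ≤ x (s + N * T) j + c := by
    intro c s hs h0 i j
    have h1 := (hsys 1 c).pow_mul_le hT.le hq0.le hq1 (min_le_right 1 ε)
      (fun t ht S hS hSu => USC.exists_arc hpos hT hconn _ ht hS hSu) hs
      (hz 1 c s (by simpa using h0) hs) i j
    have hst : 0 ≤ s + N * T := by positivity
    simp only [Fintype.card_fin, max_eq_left hs, max_eq_left hst, one_mul] at h1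
    have h2 : η * Real.exp (N * R * (s + N * T)) = q ^ N * Real.exp (N * R * s) := by
      rw [hη, mul_assoc, ← Real.exp_add]
      congr 2
      ring
    refine le_of_mul_le_mul_left ?_ (Real.exp_pos (N * R * (s + N * T)))
    calc Real.exp (N * R * (s + N * T)) * (η * (x s i + c))
        = η * Real.exp (N * R * (s + N * T)) * (x s i + c) := by ring
      _ = q ^ N * (Real.exp (N * R * s) * (x s i + c)) := by rw [h2]; ring
      _ ≤ _ := h1
  have hle : ∀ t i, ⨅ j, x t j ≤ x t i := fun t i => ciInf_le (Set.finite_range _).bddBelow i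
  have hge : ∀ t i, x t i ≤ ⨆ j, x t j := fun t i => le_ciSup (Set.finite_range _).bddAbove i
  have hup : ∀ s t, 0 ≤ s → s ≤ t → ⨆ j, x t j ≤ ⨆ j, x s j := fun s t hs hst =>
    ciSup_le fun j => by
      have := hinv (-1) (⨆ j, x s j) s t hs hst (fun i => by linarith [hge s i]) j
      linarith
  refine exists_tendsto_of_contracting_intervals (m := fun t => ⨅ j, x t j)
    (M := fun t => ⨆ j, x t j) (τ := N * T) (θ := 1 - η) (by positivity) (by linarith)
    (by linarith) (fun t _ => (hle t (Classical.arbitrary _)).trans (hge t _))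
    (fun s t hs hst => le_ciInf fun j => ?_) hup (fun t _ => hle t) (fun t _ => hge t)
    (fun t ht => ?_)
  · have := hinv 1 (-⨅ j, x s j) s t hs hst (fun i => by linarith [hle s i]) j
    linarith
  · obtain ⟨i, hi⟩ := exists_eq_ciSup_of_finite (f := fun j => x t j)
    obtain ⟨j, hj⟩ := exists_eq_ciInf_of_finite (f := fun j => x (t + N * T) j)
    have h1 := hspread (-⨅ j, x t j) t ht (fun k => by linarith [hle t k]) i j
    have h2 := hup t (t + N * T) ht (le_add_of_nonneg_right (by positivity))
    rw [← hj]
    rw [hi] at h1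
    linarith
end
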